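/- arXiv:2205.14300 — 4 statements merged into one kernel-verified Lean document; each statement's English description precedes it below -/
import Mathlib

section
/- Let d ≥ 2 and let x_1, …, x_n be distinct points on the unit sphere S^{d−1} ⊂ ℝ^d. Then the matrix H∞ ∈ ℝ^{n×n} with entries H∞_{ij} = (x_i^⊤ x_j + 1)(π − arccos(x_i^⊤ x_j))/(4π) is symmetric and positive definite. -/
open Matrix

noncomputable section

/-- The limiting NTK matrix `H∞`, with entries
`H∞_{ij} = (xᵢᵀxⱼ + 1)(π − arccos(xᵢᵀxⱼ))/(4π)`. -/
def Hinf {d n : ℕ} (x : Fin n → Fin d → ℝ) : Matrix (Fin n) (Fin n) ℝ :=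
  Matrix.of fun i j =>
    (x i ⬝ᵥ x j + 1) * (Real.pi - Real.arccos (x i ⬝ᵥ x j)) / (4 * Real.pi)

theorem multichoose_pos {a : ℝ} (ha : 0 < a) (k : ℕ) : 0 < Ring.multichoose a k := by
  have h := Ring.factorial_nsmul_multichoose_eq_ascPochhammer a k
  rw [Polynomial.ascPochhammer_smeval_eq_eval, nsmul_eq_mul] at h
  have h1 := ascPochhammer_pos k a ha
  rw [← h] at h1
  exact pos_of_mul_pos_right h1 (by positivity)

theorem hasSum_one_div_sqrt_one_sub {u : ℝ} (hu : |u| < 1) :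
    HasSum (fun k => Ring.multichoose (1 / 2 : ℝ) k * u ^ k) (1 / √(1 - u)) := by
  have h := (Real.one_div_one_sub_rpow_hasFPowerSeriesOnBall_zero (1 / 2)).hasSum
    (y := u) (by
      rw [← ENNReal.ofReal_one, Metric.eball_ofReal]
      simpa using hu)
  have hc : ∀ k : ℕ, Ring.choose ((2 : ℝ)⁻¹ + k - 1) k = Ring.multichoose (2 : ℝ)⁻¹ k := by
    intro k
    rw [Ring.choose]
    congr 1
    ring
  rw [zero_add, ← Real.sqrt_eq_rpow] at h
  simpa [FormalMultilinearSeries.ofScalars_apply_eq, hc, mul_comm] using h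

theorem posSemidef_dotProduct_pow {ι κ : Type*} [Fintype ι] [Fintype κ] (x : ι → κ → ℝ) (k : ℕ) :
    (Matrix.of fun i j => (x i ⬝ᵥ x j) ^ k).PosSemidef := by
  induction k with
  | zero =>
    have h := posSemidef_vecMulVec_self_star (fun _ : ι => (1 : ℝ))
    convert h using 1
    ext i j
    simp [vecMulVec]
  | succ k ih =>
    have h := ih.hadamard (posSemidef_self_mul_conjTranspose (Matrix.of x))
    rw [show (Matrix.of fun i j => (x i ⬝ᵥ x j) ^ (k + 1)) =
      (Matrix.of fun i j => (x i ⬝ᵥ x j) ^ k) ⊙ (Matrix.of x * (Matrix.of x)ᴴ) by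
        ext i j
        simp [pow_succ, mul_apply, dotProduct]]
    exact h

theorem sum_mul_dotProduct_pow_nonneg {ι κ : Type*} [Fintype ι] [Fintype κ] (x : ι → κ → ℝ)
    (v : ι → ℝ) (k : ℕ) : 0 ≤ ∑ i, ∑ j, v i * v j * (x i ⬝ᵥ x j) ^ k := by
  have h := (posSemidef_dotProduct_pow x k).dotProduct_mulVec_nonneg v
  simp only [dotProduct, mulVec, Finset.mul_sum, star_trivial, of_apply] at h
  refine h.trans_eq (Finset.sum_congr rfl fun i _ => Finset.sum_congr rfl fun j _ => ?_)
  simp only [dotProduct]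
  ring

theorem abs_dotProduct_le_one {κ : Type*} [Fintype κ] {y z : κ → ℝ} (hy : y ⬝ᵥ y = 1)
    (hz : z ⬝ᵥ z = 1) : |y ⬝ᵥ z| ≤ 1 := by
  have h1 : 0 ≤ (y - z) ⬝ᵥ (y - z) := by simpa using dotProduct_star_self_nonneg (y - z)
  have h2 : 0 ≤ (y + z) ⬝ᵥ (y + z) := by simpa using dotProduct_star_self_nonneg (y + z)
  simp only [sub_dotProduct, dotProduct_sub, add_dotProduct, dotProduct_add,
    dotProduct_comm z y] at h1 h2
  rw [abs_le]
  constructor <;> linarith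

theorem eq_of_dotProduct_eq_one {κ : Type*} [Fintype κ] {y z : κ → ℝ} (hy : y ⬝ᵥ y = 1)
    (hz : z ⬝ᵥ z = 1) (h : y ⬝ᵥ z = 1) : y = z := by
  have h1 : (y - z) ⬝ᵥ (y - z) = 0 := by
    simp only [sub_dotProduct, dotProduct_sub, dotProduct_comm z y]
    linarith
  exact sub_eq_zero.mp (dotProduct_self_eq_zero.mp h1)

/-- For some odd `m`, the quadratic form of the kernel `(1 + t) * t ^ m` at distinct unit
vectors is positive at a given nonzero vector. -/
theorem exists_sum_mul_one_add_mul_pow_pos {ι κ : Type*} [Fintype ι] [Fintype κ] {x : ι → κ → ℝ}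
    (hx : ∀ i, x i ⬝ᵥ x i = 1) (hinj : Function.Injective x) {v : ι → ℝ} (hv : v ≠ 0) :
    ∃ k : ℕ, 0 < ∑ i, ∑ j, v i * v j * ((1 + x i ⬝ᵥ x j) * (x i ⬝ᵥ x j) ^ (2 * k + 1)) := by
  classical
  have hlim : Filter.Tendsto
      (fun k : ℕ => ∑ i, ∑ j, v i * v j * ((1 + x i ⬝ᵥ x j) * (x i ⬝ᵥ x j) ^ (2 * k + 1)))
      Filter.atTop (nhds (∑ i, ∑ j, v i * v j * (if i = j then 2 else 0))) := by
    refine tendsto_finsetSum _ fun i _ => tendsto_finsetSum _ fun j _ =>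
      Filter.Tendsto.const_mul _ ?_
    split_ifs with hij
    · subst hij
      rw [hx i]
      norm_num
    · have hle := abs_dotProduct_le_one (hx i) (hx j)
      rcases eq_or_ne (x i ⬝ᵥ x j) (-1) with h | h
      · simp [h]
      · have hne : x i ⬝ᵥ x j ≠ 1 := fun h' => hij (hinj (eq_of_dotProduct_eq_one (hx i) (hx j) h'))
        have hlt : |x i ⬝ᵥ x j| < 1 := by
          rw [abs_le] at hle
          exact abs_lt.mpr ⟨lt_of_le_of_ne hle.1 h.symm, lt_of_le_of_ne hle.2 hne⟩
        have ht : Filter.Tendsto (fun k : ℕ => 2 * k + 1) Filter.atTop Filter.atTop :=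
          Filter.tendsto_atTop_mono (fun k => show k ≤ 2 * k + 1 by lia) Filter.tendsto_id
        simpa using ((tendsto_pow_atTop_nhds_zero_of_abs_lt_one hlt).comp ht).const_mul
          (1 + x i ⬝ᵥ x j)
  have hpos : 0 < ∑ i, ∑ j, v i * v j * (if i = j then (2 : ℝ) else 0) := by
    simp only [mul_ite, mul_zero, Finset.sum_ite_eq, Finset.mem_univ, if_true]
    obtain ⟨i, hi⟩ := Function.ne_iff.mp hv
    exact Finset.sum_pos' (fun j _ => by nlinarith [mul_self_nonneg (v j)])
      ⟨i, Finset.mem_univ i, by nlinarith [mul_self_pos.mpr hi]⟩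
  exact (hlim.eventually (lt_mem_nhds hpos)).exists

/-- The quadratic form of the kernel `(1 + t) * arcsin t` at unit vectors dominates that of each
term `(1 + t) * c * t ^ (2 * k + 1)` of its expansion. -/
theorem le_sum_mul_one_add_mul_arcsin {ι κ : Type*} [Fintype ι] [Fintype κ] {x : ι → κ → ℝ}
    (hx : ∀ i, x i ⬝ᵥ x i = 1) (v : ι → ℝ) (k : ℕ) :
    Ring.multichoose (1 / 2 : ℝ) k / (2 * k + 1) *
        ∑ i, ∑ j, v i * v j * ((1 + x i ⬝ᵥ x j) * (x i ⬝ᵥ x j) ^ (2 * k + 1)) ≤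
      ∑ i, ∑ j, v i * v j * ((1 + x i ⬝ᵥ x j) * Real.arcsin (x i ⬝ᵥ x j)) := by
  set Q : ℕ → ℝ := fun k =>
    ∑ i, ∑ j, v i * v j * ((1 + x i ⬝ᵥ x j) * (x i ⬝ᵥ x j) ^ (2 * k + 1)) with hQ
  have hQ0 : ∀ k, 0 ≤ Q k := by
    intro k
    refine (add_nonneg (sum_mul_dotProduct_pow_nonneg x v (2 * k + 1))
      (sum_mul_dotProduct_pow_nonneg x v (2 * k + 2))).trans_eq ?_
    simp only [hQ, ← Finset.sum_add_distrib]
    exact Finset.sum_congr rfl fun i _ => Finset.sum_congr rfl fun j _ => by ring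
  set c : ℕ → ℝ := fun k => Ring.multichoose (1 / 2 : ℝ) k with hc
  have hc0 : ∀ k, 0 ≤ c k := fun k => (multichoose_pos (by norm_num) k).le
  set F : ℝ → ℝ := fun s =>
    (∑ i, ∑ j, v i * v j * ((1 + x i ⬝ᵥ x j) * Real.arcsin (s * (x i ⬝ᵥ x j)))) -
      c k / (2 * k + 1) * s ^ (2 * k + 1) * Q k with hF
  have hderiv : ∀ s ∈ Set.Ioo (0 : ℝ) 1, ∃ D, 0 ≤ D ∧ HasDerivAt F D s := by
    intro s hs
    have hlt : ∀ i j, |s * (x i ⬝ᵥ x j)| < 1 := by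
      intro i j
      rw [abs_mul, abs_of_pos hs.1]
      exact (mul_le_of_le_one_right hs.1.le (abs_dotProduct_le_one (hx i) (hx j))).trans_lt hs.2
    have hsum : HasSum (fun m => c m * s ^ (2 * m) * Q m)
        (∑ i, ∑ j, v i * v j * ((1 + x i ⬝ᵥ x j) *
          (1 / √(1 - (s * (x i ⬝ᵥ x j)) ^ 2) * (x i ⬝ᵥ x j)))) := by
      have : HasSum (fun m => ∑ i, ∑ j, v i * v j * ((1 + x i ⬝ᵥ x j) *
            (c m * ((s * (x i ⬝ᵥ x j)) ^ 2) ^ m * (x i ⬝ᵥ x j))))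
          (∑ i, ∑ j, v i * v j * ((1 + x i ⬝ᵥ x j) *
            (1 / √(1 - (s * (x i ⬝ᵥ x j)) ^ 2) * (x i ⬝ᵥ x j)))) := by
        refine hasSum_sum fun i _ => hasSum_sum fun j _ => ?_
        refine (((hasSum_one_div_sqrt_one_sub ?_).mul_right _).mul_left _).mul_left _
        rw [abs_pow]
        exact pow_lt_one₀ (abs_nonneg _) (hlt i j) two_ne_zero
      convert this using 2 with m
      simp only [hQ, Finset.mul_sum]
      exact Finset.sum_congr rfl fun i _ => Finset.sum_congr rfl fun j _ => by ring
    refine ⟨_, sub_nonneg.mpr (le_hasSum hsum k fun m _ =>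
      mul_nonneg (mul_nonneg (hc0 m) (pow_nonneg hs.1.le _)) (hQ0 m)), ?_⟩
    refine HasDerivAt.sub ?_ ?_
    · refine HasDerivAt.fun_sum fun i _ => HasDerivAt.fun_sum fun j _ =>
        HasDerivAt.const_mul _ (HasDerivAt.const_mul _ ?_)
      have hij := abs_lt.mp (hlt i j)
      exact (Real.hasDerivAt_arcsin hij.1.ne' hij.2.ne).comp s (hasDerivAt_mul_const _)
    · refine HasDerivAt.mul_const ?_ _
      convert (hasDerivAt_pow (2 * k + 1) s).const_mul (c k / (2 * k + 1)) using 1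
      have : (2 * k + 1 : ℝ) ≠ 0 := by positivity
      push_cast
      field_simp
  have hcont : Continuous F := by
    have := Real.continuous_arcsin
    fun_prop
  have hmono : MonotoneOn F (Set.Icc 0 1) := by
    refine monotoneOn_of_deriv_nonneg (convex_Icc 0 1) hcont.continuousOn ?_ ?_ <;>
      rw [interior_Icc] <;> intro s hs <;> obtain ⟨D, hD, hD'⟩ := hderiv s hs
    · exact hD'.differentiableAt.differentiableWithinAt
    · rwa [hD'.deriv]
  have h01 := hmono (Set.left_mem_Icc.mpr zero_le_one) (Set.right_mem_Icc.mpr zero_le_one)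
    zero_le_one
  simpa [hF, hQ, hc] using h01

/-- **`H∞` is symmetric positive definite.** Let `d ≥ 2` and let `x_1, …, x_n` be distinct
points on the unit sphere `S^{d−1} ⊆ ℝ^d`. Then `H∞` is symmetric and positive definite. -/
theorem Hinf_isSymm_posDef {d n : ℕ} (hd : 2 ≤ d) (x : Fin n → Fin d → ℝ)
    (hx : ∀ i, x i ⬝ᵥ x i = 1) (hinj : Function.Injective x) :
    (Hinf x).IsSymm ∧ (Hinf x).PosDef := by
  have hsymm : (Hinf x).IsSymm := by
    ext i j
    simp only [Hinf, transpose_apply, of_apply, dotProduct_comm (x j) (x i)]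
  refine ⟨hsymm, .of_dotProduct_mulVec_pos ?_ fun v hv => ?_⟩
  · rw [IsHermitian, conjTranspose_eq_transpose_of_trivial]
    exact hsymm
  obtain ⟨k, hk⟩ := exists_sum_mul_one_add_mul_pow_pos hx hinj hv
  have hc : 0 < Ring.multichoose (1 / 2 : ℝ) k / (2 * k + 1) :=
    div_pos (multichoose_pos (by norm_num) k) (by positivity)
  have harcsin := (mul_pos hc hk).trans_le (le_sum_mul_one_add_mul_arcsin hx v k)
  have hlin := add_nonneg (sum_mul_dotProduct_pow_nonneg x v 0)
    (sum_mul_dotProduct_pow_nonneg x v 1)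
  have hform : star v ⬝ᵥ (Hinf x *ᵥ v) = 1 / (4 * Real.pi) *
      ((Real.pi / 2) * ((∑ i, ∑ j, v i * v j * (x i ⬝ᵥ x j) ^ 0) +
          ∑ i, ∑ j, v i * v j * (x i ⬝ᵥ x j) ^ 1) +
        ∑ i, ∑ j, v i * v j * ((1 + x i ⬝ᵥ x j) * Real.arcsin (x i ⬝ᵥ x j))) := by
    have hH : star v ⬝ᵥ (Hinf x *ᵥ v) = ∑ i, ∑ j, v i * (Hinf x i j * v j) := by
      simp only [mulVec, dotProduct, star_trivial, Finset.mul_sum]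
    rw [hH]
    simp only [Hinf, of_apply, Finset.mul_sum, ← Finset.sum_add_distrib, Real.arccos]
    exact Finset.sum_congr rfl fun i _ => Finset.sum_congr rfl fun j _ => by ring
  rw [hform]
  have := Real.pi_pos
  positivity

end
end

section
/- In the gradient descent setup, let z(k) = y − u(k) be the residual after the k-th iteration. Then for every k ≥ 0 and every η > 0 one has, entrywise, (I − 2η(H̃^+(k) + H^−(k))P) z(k) ≤ z(k+1) ≤ (I − 2η(H^+(k) + H̃^−(k))P) z(k). -/
open Matrix

noncomputable section

/-- `x̃ᵢ = (xᵢ, 1)/√2 ∈ ℝ^{d+1}`. -/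
def tildeX {d n : ℕ} (x : Fin n → Fin d → ℝ) (i : Fin n) : Fin (d + 1) → ℝ :=
  fun j => (Fin.snoc (x i) 1 : Fin (d + 1) → ℝ) j / Real.sqrt 2

/-- Network output vector `u` for weights `W` and signs `a`:
`u_i = (√2/√m) Σ_r a_r max(W_rᵀ x̃ᵢ, 0)`. -/
def netU {d n m : ℕ} (x : Fin n → Fin d → ℝ) (a : Fin m → ℝ)
    (W : Fin m → Fin (d + 1) → ℝ) : Fin n → ℝ :=
  fun i => (Real.sqrt 2 / Real.sqrt m) * ∑ r, a r * max (W r ⬝ᵥ tildeX x i) 0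

/-- Gradient descent iterates of the weights:
`w̃_r(k+1) = w̃_r(k) + (√2 η a_r/√m) Σ_i (P(y − u(k)))_i x̃_i 1{w̃_r(k)ᵀ x̃_i ≥ 0}`. -/
def gdW {d n m : ℕ} (x : Fin n → Fin d → ℝ) (y : Fin n → ℝ)
    (P : Matrix (Fin n) (Fin n) ℝ) (η : ℝ) (a : Fin m → ℝ)
    (W0 : Fin m → Fin (d + 1) → ℝ) : ℕ → Fin m → Fin (d + 1) → ℝ
  | 0 => W0
  | k + 1 => fun r =>
      gdW x y P η a W0 k r +
        (Real.sqrt 2 * η * a r / Real.sqrt m) •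
          ∑ i, (P *ᵥ (y - netU x a (gdW x y P η a W0 k))) i •
            (if 0 ≤ gdW x y P η a W0 k r ⬝ᵥ tildeX x i then tildeX x i else 0)

/-- `H(k)` for a given weight configuration `W`. -/
def Hstep {d n m : ℕ} (x : Fin n → Fin d → ℝ) (W : Fin m → Fin (d + 1) → ℝ) :
    Matrix (Fin n) (Fin n) ℝ :=
  Matrix.of fun i j => (1 / (m : ℝ)) * (tildeX x i ⬝ᵥ tildeX x j) *
    ∑ r, (if 0 ≤ W r ⬝ᵥ tildeX x i then (1 : ℝ) else 0) *
         (if 0 ≤ W r ⬝ᵥ tildeX x j then (1 : ℝ) else 0)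

/-- `H`-type matrix with the `r`-sum restricted to `S`, the row indicator taken at weights
`Wrow` and the column indicator taken at weights `Wcol`. -/
def HstepS {d n m : ℕ} (x : Fin n → Fin d → ℝ) (S : Finset (Fin m))
    (Wrow Wcol : Fin m → Fin (d + 1) → ℝ) : Matrix (Fin n) (Fin n) ℝ :=
  Matrix.of fun i j => (1 / (m : ℝ)) * (tildeX x i ⬝ᵥ tildeX x j) *
    ∑ r ∈ S, (if 0 ≤ Wrow r ⬝ᵥ tildeX x i then (1 : ℝ) else 0) *
         (if 0 ≤ Wcol r ⬝ᵥ tildeX x j then (1 : ℝ) else 0)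

/-- The increment of `max · 0` dominates its subgradient increment at the starting point. -/
theorem subgradient_mul_sub_le_relu_sub (s t : ℝ) :
    (if 0 ≤ s then (1 : ℝ) else 0) * (t - s) ≤ max t 0 - max s 0 := by
  split_ifs with h
  · rw [max_eq_left h]
    linarith [le_max_left t 0]
  · rw [max_eq_right (not_le.mp h).le]
    linarith [le_max_right t 0]

/-- One gradient step with residual weights `v`, applied to the configuration `W`. -/
def gradStep {d n m : ℕ} (x : Fin n → Fin d → ℝ) (η : ℝ) (a : Fin m → ℝ) (v : Fin n → ℝ)
    (W : Fin m → Fin (d + 1) → ℝ) : Fin m → Fin (d + 1) → ℝ :=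
  fun r => W r + (Real.sqrt 2 * η * a r / Real.sqrt m) •
    ∑ i, v i • (if 0 ≤ W r ⬝ᵥ tildeX x i then tildeX x i else 0)

theorem gradStep_dotProduct_sub {d n m : ℕ} (x : Fin n → Fin d → ℝ) (η : ℝ) (a : Fin m → ℝ)
    (v : Fin n → ℝ) (W : Fin m → Fin (d + 1) → ℝ) (r : Fin m) (i : Fin n) :
    gradStep x η a v W r ⬝ᵥ tildeX x i - W r ⬝ᵥ tildeX x i =
      (Real.sqrt 2 * η * a r / Real.sqrt m) *
        ∑ j, (tildeX x i ⬝ᵥ tildeX x j) *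
          (if 0 ≤ W r ⬝ᵥ tildeX x j then (1 : ℝ) else 0) * v j := by
  rw [gradStep, add_dotProduct, add_sub_cancel_left, smul_dotProduct, sum_dotProduct, smul_eq_mul]
  congr 1
  refine Finset.sum_congr rfl fun j _ => ?_
  rw [smul_dotProduct, smul_eq_mul, dotProduct_comm (tildeX x i)]
  split_ifs <;> simp [mul_comm]

theorem HstepS_mulVec_eq_sum_increment {d n m : ℕ} (x : Fin n → Fin d → ℝ) (η : ℝ)
    (a : Fin m → ℝ) (ha : ∀ r, a r * a r = 1) (v : Fin n → ℝ) (S : Finset (Fin m))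
    (V W : Fin m → Fin (d + 1) → ℝ) (i : Fin n) :
    2 * η * (HstepS x S V W *ᵥ v) i =
      (Real.sqrt 2 / Real.sqrt m) * ∑ r ∈ S, a r *
        ((if 0 ≤ V r ⬝ᵥ tildeX x i then (1 : ℝ) else 0) *
          (gradStep x η a v W r ⬝ᵥ tildeX x i - W r ⬝ᵥ tildeX x i)) := by
  have hc : Real.sqrt 2 / Real.sqrt m * (Real.sqrt 2 / Real.sqrt m) = 2 * (1 / (m : ℝ)) := by
    rw [div_mul_div_comm, Real.mul_self_sqrt (by norm_num), Real.mul_self_sqrt (by positivity)]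
    ring
  have hH : (HstepS x S V W *ᵥ v) i = ∑ j, (1 / (m : ℝ)) * (tildeX x i ⬝ᵥ tildeX x j) *
      (∑ r ∈ S, (if 0 ≤ V r ⬝ᵥ tildeX x i then (1 : ℝ) else 0) *
        (if 0 ≤ W r ⬝ᵥ tildeX x j then (1 : ℝ) else 0)) * v j := rfl
  simp only [hH, gradStep_dotProduct_sub, Finset.mul_sum, Finset.sum_mul]
  rw [Finset.sum_comm]
  refine Finset.sum_congr rfl fun r _ => Finset.sum_congr rfl fun j _ => ?_
  generalize (if 0 ≤ V r ⬝ᵥ tildeX x i then (1 : ℝ) else 0) = p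
  generalize (if 0 ≤ W r ⬝ᵥ tildeX x j then (1 : ℝ) else 0) = q
  linear_combination (-η * (tildeX x i ⬝ᵥ tildeX x j) * p * q * v j) * hc
    - (Real.sqrt 2 / Real.sqrt m * (Real.sqrt 2 / Real.sqrt m) *
      η * (tildeX x i ⬝ᵥ tildeX x j) * p * q * v j) * ha r

theorem sum_signs_split {m : ℕ} (a : Fin m → ℝ) (ha : ∀ r, a r = 1 ∨ a r = -1) (f : Fin m → ℝ) :
    ∑ r, f r = ∑ r ∈ Finset.univ.filter (fun r => a r = 1), f r +
      ∑ r ∈ Finset.univ.filter (fun r => a r = -1), f r := by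
  rw [← Finset.sum_filter_add_sum_filter_not Finset.univ (fun r => a r = 1)]
  congr 2
  ext r
  rcases ha r with h | h <;> norm_num [h]

theorem netU_sub_netU_gradStep_bounds {d n m : ℕ} (x : Fin n → Fin d → ℝ) (η : ℝ)
    (a : Fin m → ℝ) (ha : ∀ r, a r = 1 ∨ a r = -1) (v : Fin n → ℝ)
    (W : Fin m → Fin (d + 1) → ℝ) (i : Fin n) :
    netU x a (gradStep x η a v W) i - netU x a W i ≤
        2 * η * (HstepS x (Finset.univ.filter fun r => a r = 1) (gradStep x η a v W) W *ᵥ v) i +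
        2 * η * (HstepS x (Finset.univ.filter fun r => a r = -1) W W *ᵥ v) i ∧
      2 * η * (HstepS x (Finset.univ.filter fun r => a r = 1) W W *ᵥ v) i +
        2 * η * (HstepS x (Finset.univ.filter fun r => a r = -1) (gradStep x η a v W) W *ᵥ v) i ≤
      netU x a (gradStep x η a v W) i - netU x a W i := by
  have ha' : ∀ r, a r * a r = 1 := fun r => by rcases ha r with h | h <;> norm_num [h]
  simp only [HstepS_mulVec_eq_sum_increment x η a ha', netU]
  rw [← mul_sub, ← Finset.sum_sub_distrib, sum_signs_split a ha, ← mul_add, ← mul_add]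
  constructor <;>
  · refine mul_le_mul_of_nonneg_left (add_le_add ?_ ?_) (by positivity) <;>
    · refine Finset.sum_le_sum fun r hr => ?_
      rw [(Finset.mem_filter.mp hr).2]
      linarith [subgradient_mul_sub_le_relu_sub (W r ⬝ᵥ tildeX x i)
          (gradStep x η a v W r ⬝ᵥ tildeX x i),
        subgradient_mul_sub_le_relu_sub (gradStep x η a v W r ⬝ᵥ tildeX x i)
          (W r ⬝ᵥ tildeX x i)]

/-- **One-step sandwich for the residual (Lemma on sign flips).** In the gradient descent
setup, with `z(k) = y − u(k)`, for every `k ≥ 0` and `η > 0` one has, entrywise,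
`(I − 2η(H̃⁺(k) + H⁻(k))P) z(k) ≤ z(k+1) ≤ (I − 2η(H⁺(k) + H̃⁻(k))P) z(k)`. -/
theorem residual_one_step_sandwich {d n m : ℕ} (hd : 2 ≤ d)
    (x : Fin n → Fin d → ℝ) (hx : ∀ i, x i ⬝ᵥ x i = 1) (hinj : Function.Injective x)
    (y : Fin n → ℝ) (P : Matrix (Fin n) (Fin n) ℝ) (hP : P.PosDef)
    (a : Fin m → ℝ) (ha : ∀ r, a r = 1 ∨ a r = -1)
    (W0 : Fin m → Fin (d + 1) → ℝ) (η : ℝ) (hη : 0 < η) (k : ℕ) :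
    ∀ i,
      ((((1 : Matrix (Fin n) (Fin n) ℝ) -
          (2 * η) • ((HstepS x (Finset.univ.filter fun r => a r = 1)
                (gdW x y P η a W0 (k + 1)) (gdW x y P η a W0 k) +
              HstepS x (Finset.univ.filter fun r => a r = -1)
                (gdW x y P η a W0 k) (gdW x y P η a W0 k)) * P)) *ᵥ
          (y - netU x a (gdW x y P η a W0 k))) i
        ≤ (y - netU x a (gdW x y P η a W0 (k + 1))) i) ∧
      ((y - netU x a (gdW x y P η a W0 (k + 1))) i
        ≤ (((1 : Matrix (Fin n) (Fin n) ℝ) -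
          (2 * η) • ((HstepS x (Finset.univ.filter fun r => a r = 1)
                (gdW x y P η a W0 k) (gdW x y P η a W0 k) +
              HstepS x (Finset.univ.filter fun r => a r = -1)
                (gdW x y P η a W0 (k + 1)) (gdW x y P η a W0 k)) * P)) *ᵥ
          (y - netU x a (gdW x y P η a W0 k))) i) := by
  intro i
  have hstep : gdW x y P η a W0 (k + 1) = gradStep x η a
      (P *ᵥ (y - netU x a (gdW x y P η a W0 k))) (gdW x y P η a W0 k) := rfl
  obtain ⟨hu, hl⟩ := netU_sub_netU_gradStep_bounds x η a ha
    (P *ᵥ (y - netU x a (gdW x y P η a W0 k))) (gdW x y P η a W0 k) i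
  rw [← hstep] at hu hl
  simp only [sub_mulVec, one_mulVec, smul_mulVec, ← mulVec_mulVec, add_mulVec, Pi.sub_apply,
    Pi.smul_apply, Pi.add_apply, smul_eq_mul]
  constructor <;> linarith

end
end

section
/- In the gradient descent setup, for every t ≥ 0 one has ‖M(t)P‖_P + ‖L(t)P‖_P ≤ √( (4 M_I² M_P² n / m²) Σ_{i=1}^n |S_i(t+1)|² ) and ‖(H(0) − H(t))P‖_P ≤ √( (4 M_I² M_P² n / m²) Σ_{i=1}^n |S_i(t)|² ). -/
open Matrix

noncomputable section

/-- `‖ξ‖_P = √(ξᵀ P ξ)`. -/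
def pNorm {n : ℕ} (P : Matrix (Fin n) (Fin n) ℝ) (ξ : Fin n → ℝ) : ℝ :=
  Real.sqrt (ξ ⬝ᵥ P *ᵥ ξ)

/-- Operator norm induced by `‖·‖_P`. -/
def pOpNorm {n : ℕ} (P A : Matrix (Fin n) (Fin n) ℝ) : ℝ :=
  sSup {c | ∃ ξ : Fin n → ℝ, pNorm P ξ = 1 ∧ c = pNorm P (A *ᵥ ξ)}

/-- Euclidean norm of a vector. -/
def vecNorm {ι : Type*} [Fintype ι] (ξ : ι → ℝ) : ℝ :=
  Real.sqrt (∑ j, ξ j * ξ j)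

/-- `M_I = sup {‖ξ‖_P : ‖ξ‖₂ = 1}`. -/
def constMI {n : ℕ} (P : Matrix (Fin n) (Fin n) ℝ) : ℝ :=
  sSup {c | ∃ ξ : Fin n → ℝ, vecNorm ξ = 1 ∧ c = pNorm P ξ}

/-- `M_P = sup {‖Pξ‖₂ : ‖ξ‖_P = 1}`. -/
def constMP {n : ℕ} (P : Matrix (Fin n) (Fin n) ℝ) : ℝ :=
  sSup {c | ∃ ξ : Fin n → ℝ, pNorm P ξ = 1 ∧ c = vecNorm (P *ᵥ ξ)}

open scoped Classical in
/-- `S_i(t)`: indices `r` whose indicator at `x̃ᵢ` has flipped, relative to initialization,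
at some iteration `t′ ≤ t`. -/
def flipSet {d n m : ℕ} (x : Fin n → Fin d → ℝ) (y : Fin n → ℝ)
    (P : Matrix (Fin n) (Fin n) ℝ) (η : ℝ) (a : Fin m → ℝ)
    (W0 : Fin m → Fin (d + 1) → ℝ) (i : Fin n) (t : ℕ) : Finset (Fin m) :=
  Finset.univ.filter fun r => ∃ t' ≤ t,
    ¬((0 ≤ gdW x y P η a W0 t' r ⬝ᵥ tildeX x i) ↔ (0 ≤ gdW x y P η a W0 0 r ⬝ᵥ tildeX x i))

lemma vecNorm_sq {ι : Type*} [Fintype ι] (ξ : ι → ℝ) : vecNorm ξ ^ 2 = ∑ j, ξ j ^ 2 := by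
  rw [vecNorm, Real.sq_sqrt (Finset.sum_nonneg fun j _ => mul_self_nonneg _)]
  simp only [sq]

lemma vecNorm_nonneg {ι : Type*} [Fintype ι] (ξ : ι → ℝ) : 0 ≤ vecNorm ξ :=
  Real.sqrt_nonneg _

lemma abs_dotProduct_le_vecNorm_mul {ι : Type*} [Fintype ι] (v w : ι → ℝ) :
    |v ⬝ᵥ w| ≤ vecNorm v * vecNorm w := by
  refine abs_le_of_sq_le_sq ?_ (mul_nonneg (vecNorm_nonneg v) (vecNorm_nonneg w))
  rw [mul_pow, vecNorm_sq, vecNorm_sq]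
  exact Finset.sum_mul_sq_le_sq_mul_sq _ _ _

/-- A matrix acts on Euclidean space with norm at most its Frobenius norm. -/
lemma vecNorm_mulVec_le {ι κ : Type*} [Fintype ι] [Fintype κ] (A : Matrix ι κ ℝ) (v : κ → ℝ) :
    vecNorm (A *ᵥ v) ≤ Real.sqrt (∑ i, ∑ j, A i j ^ 2) * vecNorm v := by
  have hF : 0 ≤ ∑ i, ∑ j, A i j ^ 2 := by positivity
  refine le_of_sq_le_sq ?_ (mul_nonneg (Real.sqrt_nonneg _) (vecNorm_nonneg v))
  rw [mul_pow, Real.sq_sqrt hF, vecNorm_sq, vecNorm_sq, Finset.sum_mul]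
  exact Finset.sum_le_sum fun i _ => Finset.sum_mul_sq_le_sq_mul_sq _ _ _

open scoped MatrixOrder in
/-- The norm `‖·‖_P` is the Euclidean norm after a linear change of variables `B` with
`P = Bᵀ B`. -/
lemma exists_pNorm_eq_vecNorm {n : ℕ} {P : Matrix (Fin n) (Fin n) ℝ} (hP : P.PosDef) :
    ∃ B : Matrix (Fin n) (Fin n) ℝ, P = Bᵀ * B ∧ ∀ ξ, pNorm P ξ = vecNorm (B *ᵥ ξ) := by
  obtain ⟨B, hB⟩ := CStarAlgebra.nonneg_iff_eq_star_mul_self.mp hP.posSemidef.nonneg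
  rw [star_eq_conjTranspose, conjTranspose_eq_transpose_of_trivial] at hB
  refine ⟨B, hB, fun ξ => ?_⟩
  have h : ξ ⬝ᵥ P *ᵥ ξ = (B *ᵥ ξ) ⬝ᵥ (B *ᵥ ξ) := by
    rw [hB, ← mulVec_mulVec, dotProduct_mulVec, vecMul_transpose]
  rw [pNorm, h]
  rfl

lemma constMI_nonneg {n : ℕ} (P : Matrix (Fin n) (Fin n) ℝ) : 0 ≤ constMI P := by
  refine Real.sSup_nonneg ?_
  rintro c ⟨ξ, -, rfl⟩
  exact Real.sqrt_nonneg _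

lemma constMP_nonneg {n : ℕ} (P : Matrix (Fin n) (Fin n) ℝ) : 0 ≤ constMP P := by
  refine Real.sSup_nonneg ?_
  rintro c ⟨ξ, -, rfl⟩
  exact Real.sqrt_nonneg _

lemma vecNorm_mulVec_le_constMP {n : ℕ} {P : Matrix (Fin n) (Fin n) ℝ} (hP : P.PosDef)
    {ξ : Fin n → ℝ} (hξ : pNorm P ξ = 1) : vecNorm (P *ᵥ ξ) ≤ constMP P := by
  obtain ⟨B, hB, hnorm⟩ := exists_pNorm_eq_vecNorm hP
  refine le_csSup ⟨Real.sqrt (∑ i, ∑ j, Bᵀ i j ^ 2), ?_⟩ ⟨ξ, hξ, rfl⟩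
  rintro c ⟨ζ, hζ, rfl⟩
  have h := vecNorm_mulVec_le Bᵀ (B *ᵥ ζ)
  rwa [← hnorm, hζ, mul_one, mulVec_mulVec, ← hB] at h

lemma vecNorm_smul {ι : Type*} [Fintype ι] {c : ℝ} (hc : 0 ≤ c) (ξ : ι → ℝ) :
    vecNorm (c • ξ) = c * vecNorm ξ := by
  refine (sq_eq_sq₀ (vecNorm_nonneg _) (mul_nonneg hc (vecNorm_nonneg ξ))).mp ?_
  simp only [mul_pow, vecNorm_sq, Pi.smul_apply, smul_eq_mul, Finset.mul_sum]

lemma pNorm_le_constMI_mul {n : ℕ} {P : Matrix (Fin n) (Fin n) ℝ} (hP : P.PosDef)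
    (ξ : Fin n → ℝ) : pNorm P ξ ≤ constMI P * vecNorm ξ := by
  obtain ⟨B, -, hnorm⟩ := exists_pNorm_eq_vecNorm hP
  have hle : ∀ ζ, pNorm P ζ ≤ Real.sqrt (∑ i, ∑ j, B i j ^ 2) * vecNorm ζ := fun ζ => by
    rw [hnorm]
    exact vecNorm_mulVec_le B ζ
  rcases (vecNorm_nonneg ξ).eq_or_lt with h0 | hpos
  · simpa [← h0] using hle ξ
  have hinv : 0 ≤ (vecNorm ξ)⁻¹ := inv_nonneg.mpr hpos.le
  have hunit : vecNorm ((vecNorm ξ)⁻¹ • ξ) = 1 := by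
    rw [vecNorm_smul hinv, inv_mul_cancel₀ hpos.ne']
  have hsup : pNorm P ((vecNorm ξ)⁻¹ • ξ) ≤ constMI P := by
    refine le_csSup ⟨Real.sqrt (∑ i, ∑ j, B i j ^ 2), ?_⟩ ⟨_, hunit, rfl⟩
    rintro c ⟨ζ, hζ, rfl⟩
    simpa [hζ] using hle ζ
  rw [hnorm, mulVec_smul, vecNorm_smul hinv, ← hnorm, inv_mul_le_iff₀ hpos] at hsup
  linarith

lemma pOpNorm_mul_le {n : ℕ} {P : Matrix (Fin n) (Fin n) ℝ} (hP : P.PosDef)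
    (A : Matrix (Fin n) (Fin n) ℝ) :
    pOpNorm P (A * P) ≤ constMI P * constMP P * Real.sqrt (∑ i, ∑ j, A i j ^ 2) := by
  have hI := constMI_nonneg P
  refine Real.sSup_le ?_ (mul_nonneg (mul_nonneg hI (constMP_nonneg P)) (Real.sqrt_nonneg _))
  rintro c ⟨ξ, hξ, rfl⟩
  calc pNorm P ((A * P) *ᵥ ξ)
      ≤ constMI P * vecNorm (A *ᵥ (P *ᵥ ξ)) := by
        rw [← mulVec_mulVec]
        exact pNorm_le_constMI_mul hP _
    _ ≤ constMI P * (Real.sqrt (∑ i, ∑ j, A i j ^ 2) * constMP P) := by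
        refine mul_le_mul_of_nonneg_left ((vecNorm_mulVec_le A _).trans ?_) hI
        exact mul_le_mul_of_nonneg_left (vecNorm_mulVec_le_constMP hP hξ) (Real.sqrt_nonneg _)
    _ = _ := by ring

lemma vecNorm_tildeX {d n : ℕ} {x : Fin n → Fin d → ℝ} {i : Fin n} (hx : x i ⬝ᵥ x i = 1) :
    vecNorm (tildeX x i) = 1 := by
  have h : ∑ j, tildeX x i j * tildeX x i j = 1 := by
    have hx' : ∑ j, x i j * x i j = 1 := hx
    rw [Fin.sum_univ_castSucc]
    simp only [tildeX, Fin.snoc_castSucc, Fin.snoc_last, div_mul_div_comm,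
      Real.mul_self_sqrt zero_le_two, ← Finset.sum_div, hx']
    norm_num
  rw [vecNorm, h, Real.sqrt_one]

lemma abs_tildeX_dotProduct_le_one {d n : ℕ} {x : Fin n → Fin d → ℝ}
    (hx : ∀ i, x i ⬝ᵥ x i = 1) (i j : Fin n) : |tildeX x i ⬝ᵥ tildeX x j| ≤ 1 := by
  simpa [vecNorm_tildeX (hx _)] using abs_dotProduct_le_vecNorm_mul (tildeX x i) (tildeX x j)

lemma abs_inv_mul_mul_le {m : ℕ} {c s b : ℝ} (hc : |c| ≤ 1) (hs : |s| ≤ b) :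
    |1 / (m : ℝ) * c * s| ≤ b / m := by
  have hm : (0 : ℝ) ≤ 1 / m := by positivity
  rw [abs_mul, abs_mul, abs_of_nonneg hm]
  calc 1 / (m : ℝ) * |c| * |s| ≤ 1 / (m : ℝ) * 1 * b := by gcongr
    _ = b / m := by ring

lemma abs_HstepS_sub_le {d n m : ℕ} {x : Fin n → Fin d → ℝ} (hx : ∀ i, x i ⬝ᵥ x i = 1)
    {S T : Finset (Fin m)} {W' W V : Fin m → Fin (d + 1) → ℝ} {i : Fin n}
    (hT : ∀ r ∉ T, (0 ≤ W' r ⬝ᵥ tildeX x i ↔ 0 ≤ W r ⬝ᵥ tildeX x i)) (j : Fin n) :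
    |(HstepS x S W' V - HstepS x S W V) i j| ≤ ((S ∩ T).card : ℝ) / m := by
  simp only [Matrix.sub_apply, HstepS, of_apply, ← mul_sub, ← Finset.sum_sub_distrib, ← sub_mul]
  refine abs_inv_mul_mul_le (abs_tildeX_dotProduct_le_one hx i j) ?_
  rw [Finset.card_eq_sum_ones, ← Finset.filter_mem_eq_inter, Finset.sum_filter]
  push_cast
  refine (Finset.abs_sum_le_sum_abs _ _).trans (Finset.sum_le_sum fun r _ => ?_)
  by_cases hr : r ∈ T
  · simp only [hr, if_true]
    split_ifs <;> norm_num
  · simp [hr, hT r hr]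

lemma abs_Hstep_sub_le {d n m : ℕ} {x : Fin n → Fin d → ℝ} (hx : ∀ i, x i ⬝ᵥ x i = 1)
    {T : Fin n → Finset (Fin m)} {W' W : Fin m → Fin (d + 1) → ℝ}
    (hT : ∀ i, ∀ r ∉ T i, (0 ≤ W' r ⬝ᵥ tildeX x i ↔ 0 ≤ W r ⬝ᵥ tildeX x i)) (i j : Fin n) :
    |(Hstep x W' - Hstep x W) i j| ≤ ((T i).card + (T j).card : ℝ) / m := by
  simp only [Matrix.sub_apply, Hstep, of_apply, ← mul_sub, ← Finset.sum_sub_distrib]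
  refine abs_inv_mul_mul_le (abs_tildeX_dotProduct_le_one hx i j) ?_
  have hcard : ∀ k, ((T k).card : ℝ) = ∑ r, if r ∈ T k then 1 else 0 := fun k => by simp
  rw [hcard, hcard, ← Finset.sum_add_distrib]
  refine (Finset.abs_sum_le_sum_abs _ _).trans (Finset.sum_le_sum fun r _ => ?_)
  by_cases hi : r ∈ T i
  · by_cases hj : r ∈ T j
    · simp only [hi, hj, if_true]
      split_ifs <;> norm_num
    · simp only [hi, hj, hT j r hj, if_true, if_false]
      split_ifs <;> norm_num
  · by_cases hj : r ∈ T j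
    · simp only [hi, hj, hT i r hi, if_true, if_false]
      split_ifs <;> norm_num
    · simp [hi, hj, hT i r hi, hT j r hj]

lemma indicator_iff_of_notMem_flipSet {d n m : ℕ} {x : Fin n → Fin d → ℝ} {y : Fin n → ℝ}
    {P : Matrix (Fin n) (Fin n) ℝ} {η : ℝ} {a : Fin m → ℝ} {W0 : Fin m → Fin (d + 1) → ℝ}
    {i : Fin n} {t s s' : ℕ} {r : Fin m} (hr : r ∉ flipSet x y P η a W0 i t)
    (hs : s ≤ t) (hs' : s' ≤ t) :
    0 ≤ gdW x y P η a W0 s r ⬝ᵥ tildeX x i ↔ 0 ≤ gdW x y P η a W0 s' r ⬝ᵥ tildeX x i := by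
  simp only [flipSet, Finset.mem_filter, Finset.mem_univ, true_and, not_exists, not_and,
    not_not] at hr
  exact (hr s hs).trans (hr s' hs').symm

lemma sum_sq_le_of_abs_le_row {n : ℕ} {m : ℝ} {A : Matrix (Fin n) (Fin n) ℝ} {b : Fin n → ℝ}
    (h : ∀ i j, |A i j| ≤ b i / m) : ∑ i, ∑ j, A i j ^ 2 ≤ n / m ^ 2 * ∑ i, b i ^ 2 := by
  calc ∑ i, ∑ j, A i j ^ 2 ≤ ∑ i : Fin n, ∑ _j : Fin n, (b i / m) ^ 2 :=
        Finset.sum_le_sum fun i _ => Finset.sum_le_sum fun j _ =>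
          sq_le_sq.mpr ((h i j).trans (le_abs_self _))
    _ = n / m ^ 2 * ∑ i, b i ^ 2 := by
        rw [Finset.mul_sum]
        refine Finset.sum_congr rfl fun i _ => ?_
        simp only [Finset.sum_const, Finset.card_univ, Fintype.card_fin, nsmul_eq_mul, div_pow]
        ring

lemma sum_sq_le_of_abs_le_add {n : ℕ} {m : ℝ} {A : Matrix (Fin n) (Fin n) ℝ} {b : Fin n → ℝ}
    (h : ∀ i j, |A i j| ≤ (b i + b j) / m) :
    ∑ i, ∑ j, A i j ^ 2 ≤ 4 * n / m ^ 2 * ∑ i, b i ^ 2 := by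
  calc ∑ i, ∑ j, A i j ^ 2 ≤ ∑ i : Fin n, ∑ j : Fin n, 2 / m ^ 2 * (b i ^ 2 + b j ^ 2) := by
        refine Finset.sum_le_sum fun i _ => Finset.sum_le_sum fun j _ =>
          (sq_le_sq.mpr ((h i j).trans (le_abs_self _))).trans ?_
        rw [div_pow, div_mul_eq_mul_div]
        gcongr
        nlinarith [sq_nonneg (b i - b j)]
    _ = 4 * n / m ^ 2 * ∑ i, b i ^ 2 := by
        simp only [← Finset.mul_sum, Finset.sum_add_distrib, Finset.sum_const, Finset.card_univ,
          Fintype.card_fin, nsmul_eq_mul]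
        ring


/-- **Control of the evolution matrices by sign flips.** In the gradient descent setup,
for every `t ≥ 0`, `‖M(t)P‖_P + ‖L(t)P‖_P ≤ √((4 M_I² M_P² n / m²) Σ_i |S_i(t+1)|²)` and
`‖(H(0) − H(t))P‖_P ≤ √((4 M_I² M_P² n / m²) Σ_i |S_i(t)|²)`, where `L(t) = H̃⁺(t) − H⁺(t)`
and `M(t) = H̃⁻(t) − H⁻(t)`. -/
theorem evolution_matrices_flip_bound {d n m : ℕ} (hd : 2 ≤ d)
    (x : Fin n → Fin d → ℝ) (hx : ∀ i, x i ⬝ᵥ x i = 1) (hinj : Function.Injective x)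
    (y : Fin n → ℝ) (P : Matrix (Fin n) (Fin n) ℝ) (hP : P.PosDef)
    (a : Fin m → ℝ) (ha : ∀ r, a r = 1 ∨ a r = -1)
    (W0 : Fin m → Fin (d + 1) → ℝ) (η : ℝ) (hη : 0 < η) (t : ℕ) :
    (pOpNorm P ((HstepS x (Finset.univ.filter fun r => a r = -1)
            (gdW x y P η a W0 (t + 1)) (gdW x y P η a W0 t) -
          HstepS x (Finset.univ.filter fun r => a r = -1)
            (gdW x y P η a W0 t) (gdW x y P η a W0 t)) * P) +
        pOpNorm P ((HstepS x (Finset.univ.filter fun r => a r = 1)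
            (gdW x y P η a W0 (t + 1)) (gdW x y P η a W0 t) -
          HstepS x (Finset.univ.filter fun r => a r = 1)
            (gdW x y P η a W0 t) (gdW x y P η a W0 t)) * P) ≤
      Real.sqrt ((4 * constMI P ^ 2 * constMP P ^ 2 * n / m ^ 2) *
        ∑ i, ((flipSet x y P η a W0 i (t + 1)).card : ℝ) ^ 2)) ∧
      pOpNorm P ((Hstep x (gdW x y P η a W0 0) - Hstep x (gdW x y P η a W0 t)) * P) ≤
        Real.sqrt ((4 * constMI P ^ 2 * constMP P ^ 2 * n / m ^ 2) *
          ∑ i, ((flipSet x y P η a W0 i t).card : ℝ) ^ 2) := by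
  have hm : (0 : ℝ) ≤ n / (m : ℝ) ^ 2 := by positivity
  constructor
  · set B := Finset.univ.filter fun r => a r = -1 with hB
    set A := Finset.univ.filter fun r => a r = 1 with hA
    set T := fun i => flipSet x y P η a W0 i (t + 1)
    have hT : ∀ i, ∀ r ∉ T i, (0 ≤ gdW x y P η a W0 (t + 1) r ⬝ᵥ tildeX x i ↔
        0 ≤ gdW x y P η a W0 t r ⬝ᵥ tildeX x i) := fun i r hr =>
      indicator_iff_of_notMem_flipSet hr le_rfl t.le_succ
    have hF : ∀ S : Finset (Fin m), _ := fun S =>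
      sum_sq_le_of_abs_le_row fun i =>
        abs_HstepS_sub_le (S := S) (V := gdW x y P η a W0 t) hx (hT i)
    have hdisj : Disjoint B A := by
      rw [hB, hA, Finset.disjoint_filter]
      intro r _ h
      rw [h]
      norm_num
    have hcard : ∀ i, ((B ∩ T i).card : ℝ) ^ 2 + ((A ∩ T i).card : ℝ) ^ 2 ≤
        ((T i).card : ℝ) ^ 2 := fun i => by
      have h : ((B ∩ T i).card : ℝ) + (A ∩ T i).card ≤ (T i).card := by
        rw [← Nat.cast_add, ← Finset.card_union_of_disjoint
          (hdisj.mono Finset.inter_subset_left Finset.inter_subset_left)]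
        exact_mod_cast Finset.card_le_card
          (Finset.union_subset Finset.inter_subset_right Finset.inter_subset_right)
      nlinarith [mul_nonneg (Nat.cast_nonneg (α := ℝ) (B ∩ T i).card)
        (Nat.cast_nonneg (α := ℝ) (A ∩ T i).card)]
    have hsum := mul_le_mul_of_nonneg_left
      (Finset.sum_le_sum fun i (_ : i ∈ Finset.univ) => hcard i) hm
    rw [Finset.sum_add_distrib, mul_add] at hsum
    have hFB := hF B
    have hFA := hF A
    refine (add_le_add (pOpNorm_mul_le hP _) (pOpNorm_mul_le hP _)).trans ?_
    rw [← mul_add]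
    refine Real.le_sqrt_of_sq_le ?_
    rw [mul_pow]
    set p := ∑ i, ∑ j, (HstepS x B (gdW x y P η a W0 (t + 1)) (gdW x y P η a W0 t) -
      HstepS x B (gdW x y P η a W0 t) (gdW x y P η a W0 t)) i j ^ 2
    set q := ∑ i, ∑ j, (HstepS x A (gdW x y P η a W0 (t + 1)) (gdW x y P η a W0 t) -
      HstepS x A (gdW x y P η a W0 t) (gdW x y P η a W0 t)) i j ^ 2
    have hp0 : 0 ≤ p := by positivity
    have hq0 : 0 ≤ q := by positivity
    have hpq : (√p + √q) ^ 2 ≤ 4 * (n / (m : ℝ) ^ 2 * ∑ i, ((T i).card : ℝ) ^ 2) := by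
      nlinarith [Real.sq_sqrt hp0, Real.sq_sqrt hq0, sq_nonneg (√p - √q)]
    refine (mul_le_mul_of_nonneg_left hpq (sq_nonneg _)).trans_eq ?_
    ring
  · have hF := sum_sq_le_of_abs_le_add (abs_Hstep_sub_le hx fun i r hr =>
      indicator_iff_of_notMem_flipSet (y := y) (P := P) (η := η) (a := a) (W0 := W0)
        (s := 0) (s' := t) hr t.zero_le le_rfl)
    refine (pOpNorm_mul_le hP _).trans (Real.le_sqrt_of_sq_le ?_)
    rw [mul_pow, Real.sq_sqrt (by positivity)]
    refine (mul_le_mul_of_nonneg_left hF (sq_nonneg _)).trans_eq ?_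
    ring

end
end

section
/- Let E be a real normed vector space, A : E → E a continuous linear map, and η > 0 such that the operator norm of (id − 2ηA) is at most 1. Let v_0, …, v_L ∈ E and μ_0, …, μ_L > 0 satisfy 0 < 2ημ_ℓ ≤ 1 for every ℓ, and set e_ℓ = A v_ℓ − μ_ℓ v_ℓ. Then for every integer k ≥ 0, ‖(id − 2ηA)^k (Σ_{ℓ=0}^L v_ℓ) − Σ_{ℓ=0}^L (1 − 2ημ_ℓ)^k v_ℓ‖ ≤ Σ_{ℓ=0}^L ‖e_ℓ‖/μ_ℓ. -/
/-- A contraction `T` propagates the defect `T v - c v` of an approximate eigenvector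
at most like a geometric series of ratio `c`. -/
theorem ContinuousLinearMap.one_sub_mul_norm_pow_apply_sub_le
    {E : Type*} [NormedAddCommGroup E] [NormedSpace ℝ E]
    (T : E →L[ℝ] E) (hT : ‖T‖ ≤ 1) {c : ℝ} (hc₀ : 0 ≤ c) (hc₁ : c ≤ 1) (v : E) (k : ℕ) :
    (1 - c) * ‖(T ^ k) v - c ^ k • v‖ ≤ (1 - c ^ k) * ‖T v - c • v‖ := by
  induction k with
  | zero => simp
  | succ k ih =>
    have hsplit : (T ^ (k + 1)) v - c ^ (k + 1) • v =
        T ((T ^ k) v - c ^ k • v) + c ^ k • (T v - c • v) := by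
      rw [pow_succ' T, mul_apply_eq_comp, map_sub, map_smul, smul_sub, smul_smul,
        pow_succ]
      abel
    have hbound : ‖(T ^ (k + 1)) v - c ^ (k + 1) • v‖ ≤
        ‖(T ^ k) v - c ^ k • v‖ + c ^ k * ‖T v - c • v‖ := by
      rw [hsplit]
      refine (norm_add_le _ _).trans (add_le_add ?_ ?_)
      · simpa using T.le_of_opNorm_le hT ((T ^ k) v - c ^ k • v)
      · rw [norm_smul, Real.norm_of_nonneg (pow_nonneg hc₀ k)]
    calc (1 - c) * ‖(T ^ (k + 1)) v - c ^ (k + 1) • v‖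
        ≤ (1 - c) * (‖(T ^ k) v - c ^ k • v‖ + c ^ k * ‖T v - c • v‖) :=
          mul_le_mul_of_nonneg_left hbound (sub_nonneg.2 hc₁)
      _ ≤ (1 - c ^ k) * ‖T v - c • v‖ + (1 - c) * (c ^ k * ‖T v - c • v‖) := by
          rw [mul_add]; gcongr
      _ = (1 - c ^ (k + 1)) * ‖T v - c • v‖ := by ring

/-- **Approximate-eigenvector propagation estimate.** Let `E` be a real normed vector space,
`A : E → E` continuous linear, `η > 0` with `‖id − 2ηA‖ ≤ 1`. Let `v_0, …, v_L ∈ E` and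
`μ_0, …, μ_L > 0` with `0 < 2ημ_ℓ ≤ 1`, and set `e_ℓ = A v_ℓ − μ_ℓ v_ℓ`. Then for every `k ≥ 0`,
`‖(id − 2ηA)^k (Σ_ℓ v_ℓ) − Σ_ℓ (1 − 2ημ_ℓ)^k v_ℓ‖ ≤ Σ_ℓ ‖e_ℓ‖/μ_ℓ`. -/
theorem approx_eigenvector_propagation
    {E : Type*} [NormedAddCommGroup E] [NormedSpace ℝ E]
    (A : E →L[ℝ] E) (η : ℝ) (hη : 0 < η)
    (hA : ‖ContinuousLinearMap.id ℝ E - (2 * η) • A‖ ≤ 1)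
    {L : ℕ} (v : Fin (L + 1) → E) (μ : Fin (L + 1) → ℝ)
    (hμpos : ∀ ℓ, 0 < μ ℓ) (hμ : ∀ ℓ, 2 * η * μ ℓ ≤ 1)
    (e : Fin (L + 1) → E) (he : ∀ ℓ, e ℓ = A (v ℓ) - μ ℓ • v ℓ) (k : ℕ) :
    ‖((ContinuousLinearMap.id ℝ E - (2 * η) • A) ^ k) (∑ ℓ, v ℓ) -
        ∑ ℓ, (1 - 2 * η * μ ℓ) ^ k • v ℓ‖ ≤ ∑ ℓ, ‖e ℓ‖ / μ ℓ := by
  rw [map_sum, ← Finset.sum_sub_distrib]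
  refine norm_sum_le_of_le _ fun ℓ _ => ?_
  have hc : 0 < 2 * η * μ ℓ := by have := hμpos ℓ; positivity
  have hc₀ : 0 ≤ 1 - 2 * η * μ ℓ := by linarith [hμ ℓ]
  have hdefect : (ContinuousLinearMap.id ℝ E - (2 * η) • A) (v ℓ) - (1 - 2 * η * μ ℓ) • v ℓ =
      -((2 * η) • e ℓ) := by
    simp only [he, sub_apply, smul_apply,
      ContinuousLinearMap.id_apply]
    module
  have hmain := ContinuousLinearMap.one_sub_mul_norm_pow_apply_sub_le _ hA hc₀
    (by linarith) (v ℓ) k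
  rw [hdefect, norm_neg, norm_smul, Real.norm_of_nonneg (by positivity : 0 ≤ 2 * η),
    sub_sub_cancel] at hmain
  rw [le_div_iff₀ (hμpos ℓ)]
  refine le_of_mul_le_mul_left ?_ (by positivity : 0 < 2 * η)
  calc 2 * η * (_ * μ ℓ) = 2 * η * μ ℓ * _ := by ring
    _ ≤ _ := hmain
    _ ≤ 2 * η * ‖e ℓ‖ :=
        mul_le_of_le_one_left (by positivity) (sub_le_self _ (pow_nonneg hc₀ k))
end
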